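/- arXiv:2305.00693 — 9 statements merged into one kernel-verified Lean document; each statement's English description precedes it below -/
import Mathlib

section
/- (Bayes/Wonham filter formula) Almost surely, for each i, the conditional probability of the event {X = x_i} given the σ-algebra generated by ξ_T equals π_i(ξ_T); that is, E[1_{X = x_i} | σ(ξ_T)] = p_i exp(σ x_i ξ_T − ½σ²x_i²T) / Σ_{j=1}^{N} p_j exp(σ x_j ξ_T − ½σ²x_j²T) a.s. -/
open MeasureTheory ProbabilityTheory

/-- If the law of `ξ` on an event `A` has density `g` with respect to the law of `ξ`, then `g ∘ ξ`
is the conditional probability of `A` given `ξ`. -/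
lemma condExp_indicator_ae_eq_of_map_restrict_eq_withDensity {Ω E : Type*} {mΩ : MeasurableSpace Ω}
    {mE : MeasurableSpace E} {μ : Measure Ω} [IsFiniteMeasure μ] {A : Set Ω} (hA : MeasurableSet A)
    {ξ : Ω → E} (hξ : Measurable ξ) {g : E → ℝ} (hg : Measurable g) (hg_nonneg : 0 ≤ g)
    (h : (μ.restrict A).map ξ = (μ.map ξ).withDensity fun v => ENNReal.ofReal (g v)) :
    μ[A.indicator fun _ => (1 : ℝ) | mE.comap ξ] =ᵐ[μ] fun ω => g (ξ ω) := by
  have key : ∀ B, MeasurableSet B →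
      ∫⁻ ω in ξ ⁻¹' B, ENNReal.ofReal (g (ξ ω)) ∂μ = μ (ξ ⁻¹' B ∩ A) := by
    intro B hB
    have hBm := congrArg (fun ν : Measure E => ν B) h
    simp only [Measure.map_apply hξ hB, Measure.restrict_apply (hξ hB),
      withDensity_apply _ hB] at hBm
    rw [hBm, setLIntegral_map hB (by fun_prop) hξ]
  have hint : Integrable (fun ω => g (ξ ω)) μ := by
    refine ⟨(hg.comp hξ).aestronglyMeasurable, ?_⟩
    rw [hasFiniteIntegral_iff_ofReal (.of_forall fun ω => hg_nonneg (ξ ω))]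
    have h_univ := key Set.univ .univ
    simp only [Set.preimage_univ, Measure.restrict_univ] at h_univ
    rw [h_univ]
    exact measure_lt_top _ _
  symm
  refine ae_eq_condExp_of_forall_setIntegral_eq hξ.comap_le
    ((integrable_const _).indicator hA) (fun _ _ _ => hint.integrableOn) ?_ ?_
  · rintro _ ⟨B, hB, rfl⟩ -
    rw [integral_eq_lintegral_of_nonneg_ae (.of_forall fun ω => hg_nonneg (ξ ω))
      (hg.comp hξ).aestronglyMeasurable, key B hB, setIntegral_indicator hA]
    simp [Measure.real]
  · exact (hg.comp (comap_measurable ξ)).stronglyMeasurable.aestronglyMeasurable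

/-- On the event `{X = a}`, the variable `f X + G` is distributed as `G` shifted by `f a`. -/
lemma map_restrict_eq_of_indepFun {Ω : Type*} {mΩ : MeasurableSpace Ω} {μ : Measure Ω}
    {X G : Ω → ℝ} (hX : Measurable X) (hG : Measurable G) (hindep : IndepFun X G μ)
    {f : ℝ → ℝ} (hf : Measurable f) (a : ℝ) :
    (μ.restrict {ω | X ω = a}).map (fun ω => f (X ω) + G ω) =
      μ {ω | X ω = a} • (μ.map G).map (fun g => f a + g) := by
  ext B hB
  have hA : MeasurableSet {ω | X ω = a} := hX (measurableSet_singleton a)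
  have hset : (fun ω => f (X ω) + G ω) ⁻¹' B ∩ {ω | X ω = a} =
      X ⁻¹' {a} ∩ G ⁻¹' ((fun g => f a + g) ⁻¹' B) := by
    ext ω
    simp only [Set.mem_inter_iff, Set.mem_preimage, Set.mem_ofPred_eq, Set.mem_singleton_iff]
    constructor
    · rintro ⟨h, rfl⟩
      exact ⟨rfl, h⟩
    · rintro ⟨rfl, h⟩
      exact ⟨h, rfl⟩
  have hB' : MeasurableSet ((fun g => f a + g) ⁻¹' B) := (measurable_const_add _) hB
  rw [Measure.map_apply (by fun_prop) hB, Measure.restrict_apply' hA, hset,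
    hindep.measure_inter_preimage_eq_mul _ _ (measurableSet_singleton a) hB',
    Measure.smul_apply, Measure.map_apply (by fun_prop) hB, Measure.map_apply hG hB']
  rfl

/-- A probability measure is the sum of its restrictions to the level sets of a random variable
supported by finitely many values. -/
lemma sum_restrict_eq_of_sum_measure_eq_one {Ω ι β : Type*} {mΩ : MeasurableSpace Ω} [Fintype ι]
    [MeasurableSpace β] [MeasurableSingletonClass β]
    {μ : Measure Ω} [IsProbabilityMeasure μ] {X : Ω → β} (hX : Measurable X) {x : ι → β}
    (hx : Function.Injective x) (hsum : ∑ i, μ {ω | X ω = x i} = 1) :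
    ∑ i, μ.restrict {ω | X ω = x i} = μ := by
  have hA : ∀ i, MeasurableSet {ω | X ω = x i} := fun i => hX (measurableSet_singleton (x i))
  have hd : Pairwise (Function.onFun Disjoint fun i => {ω | X ω = x i}) := by
    intro i j hij
    refine Set.disjoint_left.2 fun ω hi hj => hij (hx ?_)
    exact hi.symm.trans hj
  have hU : μ (⋃ i, {ω | X ω = x i}) = 1 := by
    rw [measure_iUnion hd hA, tsum_fintype, hsum]
  have hae : ∀ᵐ ω ∂μ, ω ∈ ⋃ i, {ω | X ω = x i} :=
    (mem_ae_iff_prob_eq_one (MeasurableSet.iUnion hA)).2 hU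
  rw [← Measure.sum_fintype, ← Measure.restrict_iUnion hd hA, Measure.restrict_eq_self_of_ae_mem hae]

lemma gaussianPDFReal_mul_eq (s a : ℝ) {T : ℝ} (hT : 0 < T) (v : ℝ) :
    gaussianPDFReal (s * a * T) T.toNNReal v =
      gaussianPDFReal 0 T.toNNReal v * Real.exp (s * a * v - s ^ 2 * a ^ 2 * T / 2) := by
  simp only [gaussianPDFReal, Real.coe_toNNReal T hT.le]
  rw [mul_assoc _ (Real.exp _), ← Real.exp_add]
  congr 2
  field_simp
  ring

/-- **Bayes/Wonham filter formula.** Almost surely, for each `i`, the conditional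
probability of the event `{X = x i}` given the σ-algebra generated by `ξ_T`
equals `π i (ξ_T)`. -/
theorem wonham_filter_formula
    {Ω : Type*} [MeasureSpace Ω] [IsProbabilityMeasure (ℙ : Measure Ω)]
    {N : ℕ} (hN : 1 ≤ N) {T σ : ℝ} (hT : 0 < T) (hσ : 0 < σ)
    (x : Fin N → ℝ) (hx : Function.Injective x)
    (p : Fin N → ℝ) (hp : ∀ i, p i ∈ Set.Ioo (0 : ℝ) 1) (hpsum : ∑ i, p i = 1)
    (X G : Ω → ℝ) (hXmeas : Measurable X) (hGmeas : Measurable G)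
    (hX : ∀ i, ℙ {ω | X ω = x i} = ENNReal.ofReal (p i))
    (hG : Measure.map G ℙ = gaussianReal 0 T.toNNReal)
    (hindep : IndepFun X G ℙ)
    (ξ : Ω → ℝ) (hξ : ∀ ω, ξ ω = σ * X ω * T + G ω)
    (π : Fin N → ℝ → ℝ)
    (hπ : ∀ i v, π i v =
      p i * Real.exp (σ * x i * v - σ ^ 2 * x i ^ 2 * T / 2) /
        ∑ j, p j * Real.exp (σ * x j * v - σ ^ 2 * x j ^ 2 * T / 2)) :
    ∀ i, ℙ[Set.indicator {ω | X ω = x i} (fun _ => (1 : ℝ)) |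
        MeasurableSpace.comap ξ Real.measurableSpace]
      =ᵐ[ℙ] fun ω => π i (ξ ω) := by
  intro i
  have hT' : T.toNNReal ≠ 0 := by simpa using hT
  have hξ_eq : ξ = fun ω => σ * X ω * T + G ω := funext hξ
  have hξmeas : Measurable ξ := by rw [hξ_eq]; fun_prop
  have hπmeas : Measurable (π i) := by
    rw [funext (hπ i)]
    fun_prop
  have hnum : ∀ j v, 0 < p j * Real.exp (σ * x j * v - σ ^ 2 * x j ^ 2 * T / 2) :=
    fun j v => mul_pos (hp j).1 (Real.exp_pos _)
  have hden : ∀ v, 0 < ∑ j, p j * Real.exp (σ * x j * v - σ ^ 2 * x j ^ 2 * T / 2) :=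
    fun v => Finset.sum_pos (fun j _ => hnum j v) ⟨i, Finset.mem_univ i⟩
  have hπ_nonneg : 0 ≤ π i := fun v => by
    rw [hπ]
    exact (div_pos (hnum i v) (hden v)).le
  have hlaw : ∀ j, ((ℙ : Measure Ω).restrict {ω | X ω = x j}).map ξ =
      volume.withDensity fun v =>
        ENNReal.ofReal (p j * gaussianPDFReal (σ * x j * T) T.toNNReal v) := by
    intro j
    rw [hξ_eq, map_restrict_eq_of_indepFun hXmeas hGmeas hindep
        (f := fun a => σ * a * T) (by fun_prop), hX, hG, gaussianReal_map_const_add, zero_add,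
      gaussianReal_of_var_ne_zero _ hT', ← withDensity_smul _ (measurable_gaussianPDF _ _)]
    congr 1 with v
    simp [gaussianPDF, ENNReal.ofReal_mul (hp j).1.le]
  have hmarginal : Measure.map ξ ℙ = volume.withDensity fun v =>
      ENNReal.ofReal (∑ j, p j * gaussianPDFReal (σ * x j * T) T.toNNReal v) := by
    have hsum : ∑ j, ℙ {ω | X ω = x j} = 1 := by
      simp_rw [hX]
      rw [← ENNReal.ofReal_sum_of_nonneg fun j _ => (hp j).1.le, hpsum, ENNReal.ofReal_one]
    ext B hB
    conv_lhs => rw [← sum_restrict_eq_of_sum_measure_eq_one hXmeas hx hsum]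
    rw [Measure.map_apply hξmeas hB, Measure.finsetSum_apply, withDensity_apply _ hB]
    simp_rw [ENNReal.ofReal_sum_of_nonneg fun j (_ : j ∈ Finset.univ) =>
      mul_nonneg (hp j).1.le (gaussianPDFReal_nonneg _ _ _)]
    rw [lintegral_finsetSum _ fun j _ => by fun_prop]
    refine Finset.sum_congr rfl fun j _ => ?_
    rw [← Measure.map_apply hξmeas hB, hlaw j, withDensity_apply _ hB]
  refine condExp_indicator_ae_eq_of_map_restrict_eq_withDensity
    (A := {ω | X ω = x i}) (hXmeas (measurableSet_singleton (x i))) hξmeas hπmeas hπ_nonneg ?_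
  rw [hlaw i, hmarginal, ← withDensity_mul _ (by fun_prop) (by fun_prop)]
  congr 1 with v
  rw [Pi.mul_apply, ← ENNReal.ofReal_mul' (hπ_nonneg v)]
  congr 1
  simp_rw [gaussianPDFReal_mul_eq _ _ hT, mul_left_comm (p _), ← Finset.mul_sum]
  rw [hπ, mul_assoc (gaussianPDFReal _ _ _), mul_div_cancel₀ _ (hden v).ne']
end

section
/- (Two-candidate winning probability formula) P( p / (p + (1 − p) exp(σξ_T − ½σ²T)) > 1/2 ) = p·N(d⁺) + (1 − p)·N(d⁻), where d^± = (log(p/(1 − p)) ± ½σ²T) / (σ√T) and N denotes the standard normal cumulative distribution function. -/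
open MeasureTheory ProbabilityTheory

/-- The standard normal cumulative distribution function. -/
noncomputable def stdNormalCDF (y : ℝ) : ℝ :=
  ((gaussianReal 0 1) (Set.Iic y)).toReal

/-- The probability that a centred Gaussian of variance `T` lies below `√T * d`. -/
lemma gaussianReal_zero_Iio_sqrt_mul {T : ℝ} (hT : 0 < T) (d : ℝ) :
    (gaussianReal 0 T.toNNReal).real (Set.Iio (√T * d)) = stdNormalCDF d := by
  have hs : 0 < √T := Real.sqrt_pos.2 hT
  have hmap : (gaussianReal 0 1).map (√T * ·) = gaussianReal 0 T.toNNReal := by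
    rw [gaussianReal_map_const_mul]
    congr 1
    · simp
    · ext
      simp [Real.sq_sqrt hT.le, hT.le]
  have hpre : (√T * ·) ⁻¹' Set.Iio (√T * d) = Set.Iio d := by
    ext x
    simp [mul_lt_mul_iff_right₀ hs]
  have : NullSingletonClass (gaussianReal 0 1) := nullSingletonClass_gaussianReal one_ne_zero
  rw [← hmap, map_measureReal_apply (by fun_prop) measurableSet_Iio, hpre, stdNormalCDF,
    Measure.real, measure_congr Iio_ae_eq_Iic]

/-- If `X` is concentrated on two points `a ≠ b`, the probability of an event about the pair
`(X, G)` with `X` and `G` independent splits according to the value of `X`. -/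
lemma ProbabilityTheory.IndepFun.measureReal_eq_add_of_two_values {Ω α β : Type*}
    [MeasurableSpace Ω] [MeasurableSpace α] [MeasurableSingletonClass α] [MeasurableSpace β]
    {μ : Measure Ω} [IsProbabilityMeasure μ] {X : Ω → α} {G : Ω → β} (hindep : IndepFun X G μ)
    (hX : Measurable X) (hG : Measurable G) {a b : α} (hab : a ≠ b)
    (htotal : μ.real (X ⁻¹' {a}) + μ.real (X ⁻¹' {b}) = 1) {E : Set Ω} {A B : Set β}
    (hA : MeasurableSet A) (hB : MeasurableSet B)
    (hEA : ∀ ω, X ω = a → (ω ∈ E ↔ G ω ∈ A)) (hEB : ∀ ω, X ω = b → (ω ∈ E ↔ G ω ∈ B)) :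
    μ.real E = μ.real (X ⁻¹' {a}) * (μ.map G).real A + μ.real (X ⁻¹' {b}) * (μ.map G).real B := by
  have hma : MeasurableSet (X ⁻¹' {a}) := hX (measurableSet_singleton a)
  have hmb : MeasurableSet (X ⁻¹' {b}) := hX (measurableSet_singleton b)
  have hdisj : Disjoint (X ⁻¹' {a}) (X ⁻¹' {b}) :=
    Disjoint.preimage X (Set.disjoint_singleton.2 hab)
  have hunion : μ.real (X ⁻¹' {a} ∪ X ⁻¹' {b}) = 1 := by
    rw [measureReal_union hdisj hmb, htotal]
  have hae : ∀ᵐ ω ∂μ, ω ∈ X ⁻¹' {a} ∪ X ⁻¹' {b} :=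
    (mem_ae_iff_prob_eq_one (hma.union hmb)).2 ((ENNReal.toReal_eq_one_iff _).1 hunion)
  have hE : E =ᵐ[μ] (X ⁻¹' {a} ∩ G ⁻¹' A ∪ X ⁻¹' {b} ∩ G ⁻¹' B : Set Ω) := by
    filter_upwards [hae] with ω hω
    apply propext
    change ω ∈ E ↔ (X ω = a ∧ G ω ∈ A) ∨ (X ω = b ∧ G ω ∈ B)
    rcases hω with h | h
    · have h : X ω = a := h
      simp [hEA ω h, h, hab]
    · have h : X ω = b := h
      simp [hEB ω h, h, hab.symm]
  rw [measureReal_congr hE, measureReal_union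
      (hdisj.mono Set.inter_subset_left Set.inter_subset_left) (hmb.inter (hG hB)),
    map_measureReal_apply hG hA, map_measureReal_apply hG hB]
  simp only [Measure.real, ← ENNReal.toReal_mul,
    hindep.measure_inter_preimage_eq_mul _ _ (measurableSet_singleton _) hA,
    hindep.measure_inter_preimage_eq_mul _ _ (measurableSet_singleton _) hB]

/-- The posterior `p / (p + (1 - p) * exp y)` exceeds one half iff `y` is below the
prior log-odds. -/
lemma half_lt_posterior_iff {p : ℝ} (hp : p ∈ Set.Ioo (0 : ℝ) 1) (y : ℝ) :
    p / (p + (1 - p) * Real.exp y) > 1 / 2 ↔ y < Real.log (p / (1 - p)) := by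
  obtain ⟨h0, h1⟩ := hp
  have h1 : 0 < 1 - p := sub_pos.2 h1
  have hden : 0 < p + (1 - p) * Real.exp y := by positivity
  rw [Real.lt_log_iff_exp_lt (by positivity), gt_iff_lt, div_lt_div_iff₀ two_pos hden,
    lt_div_iff₀ h1]
  constructor <;> intro h <;> linarith

/-- **Two-candidate winning probability formula.**
`P(p / (p + (1 − p) exp(σξ_T − σ²T/2)) > 1/2) = p N(d⁺) + (1 − p) N(d⁻)`,
where `d^± = (log(p/(1 − p)) ± σ²T/2) / (σ√T)`. -/
theorem two_candidate_winning_probability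
    {Ω : Type*} [MeasureSpace Ω] [IsProbabilityMeasure (ℙ : Measure Ω)]
    {T σ p : ℝ} (hT : 0 < T) (hσ : 0 < σ) (hp : p ∈ Set.Ioo (0 : ℝ) 1)
    (X G : Ω → ℝ) (hXmeas : Measurable X) (hGmeas : Measurable G)
    (hX0 : ℙ {ω | X ω = 0} = ENNReal.ofReal p)
    (hX1 : ℙ {ω | X ω = 1} = ENNReal.ofReal (1 - p))
    (hG : Measure.map G ℙ = gaussianReal 0 T.toNNReal)
    (hindep : IndepFun X G ℙ)
    (ξ : Ω → ℝ) (hξ : ∀ ω, ξ ω = σ * X ω * T + G ω) :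
    (ℙ {ω | p / (p + (1 - p) * Real.exp (σ * ξ ω - σ ^ 2 * T / 2)) > 1 / 2}).toReal
      = p * stdNormalCDF ((Real.log (p / (1 - p)) + σ ^ 2 * T / 2) / (σ * Real.sqrt T))
        + (1 - p) * stdNormalCDF ((Real.log (p / (1 - p)) - σ ^ 2 * T / 2) / (σ * Real.sqrt T)) := by
  have hs : 0 < √T := Real.sqrt_pos.2 hT
  have hp0 : (ℙ : Measure Ω).real (X ⁻¹' {0}) = p :=
    (congrArg ENNReal.toReal hX0).trans (ENNReal.toReal_ofReal hp.1.le)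
  have hp1 : (ℙ : Measure Ω).real (X ⁻¹' {1}) = 1 - p :=
    (congrArg ENNReal.toReal hX1).trans (ENNReal.toReal_ofReal (sub_nonneg.2 hp.2.le))
  have hthreshold (c : ℝ) : √T * (c / (σ * √T)) = c / σ := by field_simp
  have key := hindep.measureReal_eq_add_of_two_values hXmeas hGmeas zero_ne_one
    (by rw [hp0, hp1]; ring)
    (E := {ω | p / (p + (1 - p) * Real.exp (σ * ξ ω - σ ^ 2 * T / 2)) > 1 / 2})
    (A := Set.Iio (√T * ((Real.log (p / (1 - p)) + σ ^ 2 * T / 2) / (σ * √T))))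
    (B := Set.Iio (√T * ((Real.log (p / (1 - p)) - σ ^ 2 * T / 2) / (σ * √T))))
    measurableSet_Iio measurableSet_Iio
    (fun ω h ↦ by
      rw [Set.mem_ofPred_eq, half_lt_posterior_iff hp, hξ, h, Set.mem_Iio, hthreshold,
        lt_div_iff₀ hσ]
      constructor <;> intro h <;> linarith)
    (fun ω h ↦ by
      rw [Set.mem_ofPred_eq, half_lt_posterior_iff hp, hξ, h, Set.mem_Iio, hthreshold,
        lt_div_iff₀ hσ]
      constructor <;> intro h <;> linarith)
  rwa [hp0, hp1, hG, gaussianReal_zero_Iio_sqrt_mul hT, gaussianReal_zero_Iio_sqrt_mul hT] at key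
end

section
/- (Winning probability versus current poll) Let f(p) = p·N(d⁺) + (1 − p)·N(d⁻) with d^± = (log(p/(1 − p)) ± ½σ²T)/(σ√T), where N is the standard normal cumulative distribution function. Then for every p ∈ (1/2, 1) one has f(p) > p, and for every p ∈ (0, 1/2) one has f(p) < p. -/
open MeasureTheory ProbabilityTheory

/-- The standard normal CDF at a shifted point, as the integral of a shifted Gaussian density. -/
lemma stdNormalCDF_sub_eq_setIntegral (a c : ℝ) :
    stdNormalCDF (c - a) = ∫ v in Set.Iic c, gaussianPDFReal a 1 v := by
  have h : (gaussianReal 0 1).map (fun x ↦ x + a) = gaussianReal a 1 := by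
    rw [gaussianReal_map_add_const, zero_add]
  have h2 : (gaussianReal a 1) (Set.Iic c) = (gaussianReal 0 1) (Set.Iic (c - a)) := by
    rw [← h, Measure.map_apply (by fun_prop) measurableSet_Iic]
    congr 1
    ext x
    simp [le_sub_iff_add_le]
  rw [stdNormalCDF, ← h2, gaussianReal_apply_eq_integral _ one_ne_zero,
    ENNReal.toReal_ofReal (integral_nonneg fun v ↦ gaussianPDFReal_nonneg _ _ _)]

/-- Symmetry of the standard normal CDF. -/
lemma stdNormalCDF_neg (y : ℝ) : stdNormalCDF (-y) = 1 - stdNormalCDF y := by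
  have h : (gaussianReal 0 1).map (fun x : ℝ ↦ -x) = gaussianReal 0 1 := by
    rw [gaussianReal_map_neg, neg_zero]
  have := nullSingletonClass_gaussianReal (μ := 0) (v := 1) one_ne_zero
  have h2 : (gaussianReal 0 1) (Set.Iic (-y)) = (gaussianReal 0 1) (Set.Iic y)ᶜ := by
    conv_lhs => rw [← h, Measure.map_apply (by fun_prop) measurableSet_Iic]
    rw [Set.compl_Iic, ← measure_congr Ioi_ae_eq_Ici.symm]
    congr 1
    ext x
    simp
  have h3 := probReal_compl_eq_one_sub (μ := gaussianReal 0 1) (measurableSet_Iic (a := y))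
  rw [stdNormalCDF, h2]
  exact h3

/-- The Gaussian densities with means `a` and `-a` differ by an exponential tilt. -/
lemma exp_mul_gaussianPDFReal_eq (a s v : ℝ) :
    Real.exp (a * s) * gaussianPDFReal a 1 v =
      Real.exp (a * (s + 2 * v)) * gaussianPDFReal (-a) 1 v := by
  simp only [gaussianPDFReal_def]
  rw [mul_left_comm, mul_left_comm (Real.exp (a * (s + 2 * v))), ← Real.exp_add, ← Real.exp_add]
  congr 2
  simp only [NNReal.coe_one]
  ring

lemma exp_mul_stdNormalCDF_lt {a : ℝ} (ha : 0 < a) (s : ℝ) :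
    Real.exp (a * s) * stdNormalCDF (-(a + s / 2)) < stdNormalCDF (a - s / 2) := by
  have e1 : -(a + s / 2) = -s / 2 - a := by ring
  have e2 : a - s / 2 = -s / 2 - -a := by ring
  rw [e1, e2, stdNormalCDF_sub_eq_setIntegral, stdNormalCDF_sub_eq_setIntegral,
    ← integral_const_mul]
  have i1 := ((integrable_gaussianPDFReal a 1).const_mul (Real.exp (a * s))).integrableOn
    (s := Set.Iic (-s / 2))
  have i2 := (integrable_gaussianPDFReal (-a) 1).integrableOn (s := Set.Iic (-s / 2))
  rw [← sub_pos, ← integral_sub i2 i1]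
  have hpos (v : ℝ) : 0 < gaussianPDFReal (-a) 1 v := gaussianPDFReal_pos _ _ _ one_ne_zero
  have hfactor (v : ℝ) : gaussianPDFReal (-a) 1 v - Real.exp (a * s) * gaussianPDFReal a 1 v =
      (1 - Real.exp (a * (s + 2 * v))) * gaussianPDFReal (-a) 1 v := by
    rw [exp_mul_gaussianPDFReal_eq]
    ring
  refine (setIntegral_pos_iff_support_of_nonneg_ae ?_ (i2.sub i1)).2 ?_
  · filter_upwards [ae_restrict_mem measurableSet_Iic] with v hv
    have hv : v ≤ -s / 2 := hv
    simp only [Pi.zero_apply, Pi.sub_apply, hfactor]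
    refine mul_nonneg (sub_nonneg.2 ?_) (hpos v).le
    rw [Real.exp_le_one_iff]
    nlinarith
  · refine lt_of_lt_of_le ?_ (measure_mono (s := Set.Iio (-s / 2)) ?_)
    · simp
    · intro v hv
      have hv : v < -s / 2 := hv
      refine ⟨?_, hv.le⟩
      simp only [Function.mem_support, Pi.sub_apply, hfactor]
      refine (mul_pos (sub_pos.2 ?_) (hpos v)).ne'
      rw [Real.exp_lt_one_iff]
      nlinarith

/-- **Winning probability versus current poll.** With
`f(p) = p N(d⁺) + (1 − p) N(d⁻)`, `d^± = (log(p/(1 − p)) ± σ²T/2)/(σ√T)`,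
one has `f(p) > p` for `p ∈ (1/2, 1)` and `f(p) < p` for `p ∈ (0, 1/2)`. -/
theorem winning_probability_vs_poll
    {T σ : ℝ} (hT : 0 < T) (hσ : 0 < σ) :
    (∀ p ∈ Set.Ioo (1 / 2 : ℝ) 1,
      p * stdNormalCDF ((Real.log (p / (1 - p)) + σ ^ 2 * T / 2) / (σ * Real.sqrt T))
        + (1 - p) * stdNormalCDF ((Real.log (p / (1 - p)) - σ ^ 2 * T / 2) / (σ * Real.sqrt T))
      > p) ∧
    (∀ p ∈ Set.Ioo (0 : ℝ) (1 / 2),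
      p * stdNormalCDF ((Real.log (p / (1 - p)) + σ ^ 2 * T / 2) / (σ * Real.sqrt T))
        + (1 - p) * stdNormalCDF ((Real.log (p / (1 - p)) - σ ^ 2 * T / 2) / (σ * Real.sqrt T))
      < p) := by
  have hs : 0 < σ * √T := mul_pos hσ (Real.sqrt_pos.2 hT)
  have hsq : σ ^ 2 * T = (σ * √T) ^ 2 := by rw [mul_pow, Real.sq_sqrt hT.le]
  rw [hsq]
  generalize σ * √T = s at hs
  have hd₁ (x : ℝ) : (x + s ^ 2 / 2) / s = x / s + s / 2 := by field_simp
  have hd₂ (x : ℝ) : (x - s ^ 2 / 2) / s = x / s - s / 2 := by field_simp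
  simp only [hd₁, hd₂]
  constructor
  · rintro p ⟨hp, hp'⟩
    have hq : 0 < 1 - p := by linarith
    have hx : 0 < Real.log (p / (1 - p)) := Real.log_pos (by rw [lt_div_iff₀ hq]; linarith)
    have key := exp_mul_stdNormalCDF_lt (div_pos hx hs) s
    rw [div_mul_cancel₀ _ hs.ne', Real.exp_log (by positivity), stdNormalCDF_neg, div_mul_eq_mul_div,
      div_lt_iff₀ hq] at key
    linarith
  · rintro p ⟨hp, hp'⟩
    have hq : 0 < 1 - p := by linarith
    have hx : Real.log (p / (1 - p)) < 0 :=
      Real.log_neg (by positivity) (by rw [div_lt_iff₀ hq]; linarith)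
    have key := exp_mul_stdNormalCDF_lt (neg_pos.2 (div_neg_of_neg_of_pos hx hs)) s
    have e₁ : -(-(Real.log (p / (1 - p)) / s) + s / 2) = Real.log (p / (1 - p)) / s - s / 2 := by
      ring
    have e₂ : -(Real.log (p / (1 - p)) / s) - s / 2 = -(Real.log (p / (1 - p)) / s + s / 2) := by
      ring
    rw [e₁, e₂, neg_mul, div_mul_cancel₀ _ hs.ne', Real.exp_neg, Real.exp_log (by positivity),
      stdNormalCDF_neg, inv_div, div_mul_eq_mul_div, div_lt_iff₀ hp] at key
    linarith
end

section
/- (Explicit ordering probability, first case) P( π_3(ξ_T) < π_2(ξ_T) < π_1(ξ_T) ) = Σ_{j=1}^{3} p_j · N( (min{z_{12}, z_{23}} − σ x_j T)/√T ), where N denotes the standard normal cumulative distribution function. -/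
open MeasureTheory ProbabilityTheory

/-- The probability that a centred Gaussian of variance `T` lies strictly below `a`. -/
lemma gaussianReal_Iio_eq_stdNormalCDF {T : ℝ} (hT : 0 < T) (a : ℝ) :
    (gaussianReal 0 T.toNNReal (Set.Iio a)).toReal = stdNormalCDF (a / Real.sqrt T) := by
  have hs : 0 < Real.sqrt T := Real.sqrt_pos.2 hT
  have hmap : gaussianReal 0 T.toNNReal = (gaussianReal 0 1).map (Real.sqrt T * ·) := by
    rw [gaussianReal_map_const_mul]
    congr 1
    · simp
    · ext
      simp [hT.le]
  have : NullSingletonClass (gaussianReal 0 1) := nullSingletonClass_gaussianReal one_ne_zero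
  have hpre : (Real.sqrt T * ·) ⁻¹' Set.Iio a = Set.Iio (a / Real.sqrt T) := by
    ext y
    simp [lt_div_iff₀ hs, mul_comm]
  rw [hmap, Measure.map_apply (by fun_prop) measurableSet_Iio, hpre, stdNormalCDF,
    measure_congr Iio_ae_eq_Iic]

/-- Comparison of two exponentially tilted weights reduces to a threshold on `v`. -/
lemma tilted_weight_lt_iff {σ T a b p q v : ℝ} (hσ : 0 < σ) (hab : a < b)
    (hp : 0 < p) (hq : 0 < q) :
    q * Real.exp (σ * b * v - σ ^ 2 * b ^ 2 * T / 2)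
        < p * Real.exp (σ * a * v - σ ^ 2 * a ^ 2 * T / 2) ↔
      v < (Real.log (q / p) + σ ^ 2 * (a ^ 2 - b ^ 2) * T / 2) / (σ * (a - b)) := by
  have hneg : σ * (a - b) < 0 := mul_neg_of_pos_of_neg hσ (sub_neg.2 hab)
  rw [lt_div_iff_of_neg hneg, Real.log_div hq.ne' hp.ne',
    ← Real.log_lt_log_iff (by positivity) (by positivity),
    Real.log_mul hq.ne' (Real.exp_ne_zero _), Real.log_mul hp.ne' (Real.exp_ne_zero _),
    Real.log_exp, Real.log_exp]
  constructor <;> intro h <;> linarith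

/-- A random variable taking each of finitely many distinct values `x i` with probability `p i`,
where the `p i` sum to one, almost surely takes one of these values. -/
lemma ae_mem_range_of_measure_eq {Ω ι : Type*} [MeasurableSpace Ω] {μ : Measure Ω}
    [IsProbabilityMeasure μ] [Fintype ι] {x p : ι → ℝ} (hx : Function.Injective x)
    (hp : ∀ i, 0 ≤ p i) (hpsum : ∑ i, p i = 1) {X : Ω → ℝ} (hXmeas : Measurable X)
    (hX : ∀ i, μ {ω | X ω = x i} = ENNReal.ofReal (p i)) :
    ∀ᵐ ω ∂μ, ω ∈ ⋃ i, {ω | X ω = x i} := by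
  have hm : ∀ i, MeasurableSet {ω | X ω = x i} := fun i => hXmeas (measurableSet_singleton (x i))
  refine (mem_ae_iff_prob_eq_one (MeasurableSet.iUnion hm)).2 ?_
  rw [measure_iUnion _ hm, tsum_fintype]
  · simp_rw [hX]
    rw [← ENNReal.ofReal_sum_of_nonneg fun i _ => hp i, hpsum, ENNReal.ofReal_one]
  · intro i j hij
    refine Set.disjoint_left.2 fun ω (hi : X ω = x i) (hj : X ω = x j) => hij (hx (hi.symm.trans hj))

/-- **Explicit ordering probability, first case.**
`P(π₃(ξ_T) < π₂(ξ_T) < π₁(ξ_T)) = ∑ j, p j * N((min {z₁₂, z₂₃} − σ x_j T)/√T)`.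
(Candidates `1,2,3` correspond to indices `0,1,2` of `Fin 3`.) -/
theorem ordering_probability_first_case
    {Ω : Type*} [MeasureSpace Ω] [IsProbabilityMeasure (ℙ : Measure Ω)]
    {T σ : ℝ} (hT : 0 < T) (hσ : 0 < σ)
    (x : Fin 3 → ℝ) (hx : StrictMono x)
    (p : Fin 3 → ℝ) (hp : ∀ i, p i ∈ Set.Ioo (0 : ℝ) 1) (hpsum : ∑ i, p i = 1)
    (π : Fin 3 → ℝ → ℝ)
    (hπ : ∀ i v, π i v =
      p i * Real.exp (σ * x i * v - σ ^ 2 * x i ^ 2 * T / 2) /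
        ∑ j, p j * Real.exp (σ * x j * v - σ ^ 2 * x j ^ 2 * T / 2))
    (z : Fin 3 → Fin 3 → ℝ)
    (hz : ∀ k j, k ≠ j → z k j =
      (Real.log (p j / p k) + σ ^ 2 * (x k ^ 2 - x j ^ 2) * T / 2) / (σ * (x k - x j)))
    (X G : Ω → ℝ) (hXmeas : Measurable X) (hGmeas : Measurable G)
    (hX : ∀ i, ℙ {ω | X ω = x i} = ENNReal.ofReal (p i))
    (hG : Measure.map G ℙ = gaussianReal 0 T.toNNReal)
    (hindep : IndepFun X G ℙ)
    (ξ : Ω → ℝ) (hξ : ∀ ω, ξ ω = σ * X ω * T + G ω) :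
    (ℙ {ω | π 2 (ξ ω) < π 1 (ξ ω) ∧ π 1 (ξ ω) < π 0 (ξ ω)}).toReal
      = ∑ j, p j * stdNormalCDF ((min (z 0 1) (z 1 2) - σ * x j * T) / Real.sqrt T) := by
  have hpos : ∀ i, 0 < p i := fun i => (hp i).1
  have hD : ∀ v, 0 < ∑ j, p j * Real.exp (σ * x j * v - σ ^ 2 * x j ^ 2 * T / 2) := fun v =>
    Finset.sum_pos (fun j _ => mul_pos (hpos j) (Real.exp_pos _)) Finset.univ_nonempty
  have h_lt : ∀ i j, i < j → ∀ v, π j v < π i v ↔ v < z i j := fun i j hij v => by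
    rw [hπ, hπ, div_lt_div_iff_of_pos_right (hD v),
      tilted_weight_lt_iff hσ (hx hij) (hpos i) (hpos j), hz i j hij.ne]
  set m := min (z 0 1) (z 1 2)
  have hm : ∀ j, MeasurableSet {ω | X ω = x j} := fun j => hXmeas (measurableSet_singleton (x j))
  have hGm : ∀ a, MeasurableSet (G ⁻¹' Set.Iio a) := fun a => hGmeas measurableSet_Iio
  have hevent : {ω | π 2 (ξ ω) < π 1 (ξ ω) ∧ π 1 (ξ ω) < π 0 (ξ ω)} =ᵐ[ℙ]
      ⋃ j, ({ω | X ω = x j} ∩ G ⁻¹' Set.Iio (m - σ * x j * T) : Set Ω) := by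
    filter_upwards [ae_mem_range_of_measure_eq hx.injective (fun i => (hpos i).le) hpsum
      hXmeas hX] with ω hω
    obtain ⟨j, hj⟩ := Set.mem_iUnion.1 hω
    refine propext ⟨fun h => ?_, fun h => ?_⟩
    · have hj' : X ω = x j := hj
      have h' : ξ ω < m := lt_min ((h_lt 0 1 (by decide) _).1 h.2) ((h_lt 1 2 (by decide) _).1 h.1)
      rw [hξ, hj'] at h'
      exact Set.mem_iUnion.2 ⟨j, hj, lt_sub_iff_add_lt'.2 h'⟩
    · obtain ⟨k, hk, hGk⟩ := Set.mem_iUnion.1 h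
      have hk' : X ω = x k := hk
      have h' : ξ ω < m := by
        rw [hξ, hk']
        exact lt_sub_iff_add_lt'.1 hGk
      exact ⟨(h_lt 1 2 (by decide) _).2 (h'.trans_le (min_le_right _ _)),
        (h_lt 0 1 (by decide) _).2 (h'.trans_le (min_le_left _ _))⟩
  rw [measure_congr hevent, measure_iUnion _ fun j => (hm j).inter (hGm _), tsum_fintype,
    ENNReal.toReal_sum fun j _ => measure_ne_top _ _]
  · refine Finset.sum_congr rfl fun j _ => ?_
    have hind := hindep.measure_inter_preimage_eq_mul {x j} (Set.Iio (m - σ * x j * T))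
      (measurableSet_singleton _) measurableSet_Iio
    rw [← Measure.map_apply hGmeas measurableSet_Iio, hG] at hind
    rw [← gaussianReal_Iio_eq_stdNormalCDF hT, ← ENNReal.toReal_ofReal (hpos j).le, ← hX j,
      ← ENNReal.toReal_mul]
    exact congrArg ENNReal.toReal hind
  · intro i j hij
    exact Set.disjoint_left.2 fun ω hi hj => hij (hx.injective (hi.1.symm.trans hj.1))
end

section
/- (Explicit ordering probability, second case) If z_{23} < z_{31}, then P( π_2(ξ_T) < π_3(ξ_T) < π_1(ξ_T) ) = Σ_{j=1}^{3} p_j [ N((z_{31} − σ x_j T)/√T) − N((z_{23} − σ x_j T)/√T) ]; and if z_{23} ≥ z_{31}, then P( π_2(ξ_T) < π_3(ξ_T) < π_1(ξ_T) ) = 0. Here N denotes the standard normal cumulative distribution function. -/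
open MeasureTheory ProbabilityTheory

/-- A centred Gaussian interval probability in terms of the standard normal distribution function. -/
lemma gaussianReal_real_Ioo {T a b : ℝ} (hT : 0 < T) (hab : a ≤ b) :
    (gaussianReal 0 T.toNNReal).real (Set.Ioo a b)
      = stdNormalCDF (b / √T) - stdNormalCDF (a / √T) := by
  have hs : 0 < √T := Real.sqrt_pos.2 hT
  have hmap : (gaussianReal 0 1).map (√T * ·) = gaussianReal 0 T.toNNReal := by
    rw [gaussianReal_map_const_mul, mul_zero, mul_one]
    congr 1
    ext
    simp [Real.sq_sqrt hT.le, hT.le]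
  have hpre : (√T * ·) ⁻¹' Set.Ioo a b = Set.Ioo (a / √T) (b / √T) := by
    ext y
    simp [div_lt_iff₀' hs, lt_div_iff₀' hs]
  have : NullSingletonClass (gaussianReal 0 1) := nullSingletonClass_gaussianReal one_ne_zero
  rw [← hmap, map_measureReal_apply (by fun_prop) measurableSet_Ioo, hpre,
    measureReal_congr Ioo_ae_eq_Ioc, ← Set.Iic_sdiff_Iic,
    measureReal_sdiff (Set.Iic_subset_Iic.2 (by gcongr)) measurableSet_Iic]
  rfl

/-- Comparing two exponential weights amounts to comparing the observation with a threshold. -/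
lemma mul_exp_lt_mul_exp_iff {p q a b c d v : ℝ} (hp : 0 < p) (hq : 0 < q) (hac : a < c) :
    p * Real.exp (a * v - b) < q * Real.exp (c * v - d) ↔
      (Real.log (p / q) + d - b) / (c - a) < v := by
  rw [← Real.log_lt_log_iff (by positivity) (by positivity),
    Real.log_mul hp.ne' (Real.exp_ne_zero _), Real.log_mul hq.ne' (Real.exp_ne_zero _),
    Real.log_exp, Real.log_exp, Real.log_div hp.ne' hq.ne', div_lt_iff₀ (sub_pos.2 hac)]
  constructor <;> intro h <;> linarith

/-- The reversed comparison of `mul_exp_lt_mul_exp_iff`. -/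
lemma mul_exp_lt_mul_exp_iff' {p q a b c d v : ℝ} (hp : 0 < p) (hq : 0 < q) (hac : a < c) :
    q * Real.exp (c * v - d) < p * Real.exp (a * v - b) ↔
      v < (Real.log (p / q) + d - b) / (c - a) := by
  rw [← Real.log_lt_log_iff (by positivity) (by positivity),
    Real.log_mul hp.ne' (Real.exp_ne_zero _), Real.log_mul hq.ne' (Real.exp_ne_zero _),
    Real.log_exp, Real.log_exp, Real.log_div hp.ne' hq.ne', lt_div_iff₀ (sub_pos.2 hac)]
  constructor <;> intro h <;> linarith

/-- Law of total probability over finitely many atoms of `X` that carry all the mass. -/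
lemma measureReal_eq_sum_inter_of_sum_eq_one {Ω ι : Type*} [Fintype ι] [MeasurableSpace Ω]
    {μ : Measure Ω} [IsProbabilityMeasure μ] {X : Ω → ℝ} (hX : Measurable X) {x : ι → ℝ}
    (hx : Function.Injective x) (hsum : ∑ i, μ.real (X ⁻¹' {x i}) = 1)
    {s : Set Ω} (hs : MeasurableSet s) :
    μ.real s = ∑ i, μ.real (X ⁻¹' {x i} ∩ s) := by
  have hm : ∀ i, MeasurableSet (X ⁻¹' {x i}) := fun i ↦ hX (measurableSet_singleton _)
  have hd : Pairwise (Function.onFun Disjoint fun i ↦ X ⁻¹' {x i}) := fun i j hij ↦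
    Disjoint.preimage X (Set.disjoint_singleton.2 (hx.ne hij))
  have hU : μ.real (⋃ i, X ⁻¹' {x i}) = 1 := by
    rw [measureReal_iUnion_fintype hd hm, hsum]
  have hae : μ.real (⋃ i, X ⁻¹' {x i})ᶜ = 0 := by
    rw [probReal_compl_eq_one_sub (MeasurableSet.iUnion hm), hU, sub_self]
  have hdiff : μ.real (s \ ⋃ i, X ⁻¹' {x i}) = 0 :=
    measureReal_mono_null (fun _ h ↦ h.2) hae
  rw [← measureReal_inter_add_sdiff (s := s) (MeasurableSet.iUnion hm), hdiff, add_zero,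
    Set.inter_comm, Set.iUnion_inter, measureReal_iUnion_fintype
      (fun i j hij ↦ (hd hij).mono Set.inter_subset_left Set.inter_subset_left)
      (fun i ↦ (hm i).inter hs)]

/-- **Explicit ordering probability, second case.** If `z₂₃ < z₃₁`, then
`P(π₂(ξ_T) < π₃(ξ_T) < π₁(ξ_T)) = ∑ j, p j * (N((z₃₁ − σ x_j T)/√T) − N((z₂₃ − σ x_j T)/√T))`;
and if `z₂₃ ≥ z₃₁`, then `P(π₂(ξ_T) < π₃(ξ_T) < π₁(ξ_T)) = 0`.
(Candidates `1,2,3` correspond to indices `0,1,2` of `Fin 3`.) -/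
theorem ordering_probability_second_case
    {Ω : Type*} [MeasureSpace Ω] [IsProbabilityMeasure (ℙ : Measure Ω)]
    {T σ : ℝ} (hT : 0 < T) (hσ : 0 < σ)
    (x : Fin 3 → ℝ) (hx : StrictMono x)
    (p : Fin 3 → ℝ) (hp : ∀ i, p i ∈ Set.Ioo (0 : ℝ) 1) (hpsum : ∑ i, p i = 1)
    (π : Fin 3 → ℝ → ℝ)
    (hπ : ∀ i v, π i v =
      p i * Real.exp (σ * x i * v - σ ^ 2 * x i ^ 2 * T / 2) /
        ∑ j, p j * Real.exp (σ * x j * v - σ ^ 2 * x j ^ 2 * T / 2))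
    (z : Fin 3 → Fin 3 → ℝ)
    (hz : ∀ k j, k ≠ j → z k j =
      (Real.log (p j / p k) + σ ^ 2 * (x k ^ 2 - x j ^ 2) * T / 2) / (σ * (x k - x j)))
    (X G : Ω → ℝ) (hXmeas : Measurable X) (hGmeas : Measurable G)
    (hX : ∀ i, ℙ {ω | X ω = x i} = ENNReal.ofReal (p i))
    (hG : Measure.map G ℙ = gaussianReal 0 T.toNNReal)
    (hindep : IndepFun X G ℙ)
    (ξ : Ω → ℝ) (hξ : ∀ ω, ξ ω = σ * X ω * T + G ω) :
    (z 1 2 < z 2 0 →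
      (ℙ {ω | π 1 (ξ ω) < π 2 (ξ ω) ∧ π 2 (ξ ω) < π 0 (ξ ω)}).toReal
        = ∑ j, p j * (stdNormalCDF ((z 2 0 - σ * x j * T) / Real.sqrt T)
            - stdNormalCDF ((z 1 2 - σ * x j * T) / Real.sqrt T))) ∧
    (z 2 0 ≤ z 1 2 →
      ℙ {ω | π 1 (ξ ω) < π 2 (ξ ω) ∧ π 2 (ξ ω) < π 0 (ξ ω)} = 0) := by
  have hp0 : ∀ i, 0 < p i := fun i ↦ (hp i).1
  have hden : ∀ v, 0 < ∑ j, p j * Real.exp (σ * x j * v - σ ^ 2 * x j ^ 2 * T / 2) := fun v ↦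
    Finset.sum_pos (fun j _ ↦ mul_pos (hp0 j) (Real.exp_pos _)) Finset.univ_nonempty
  have h12 : x 1 < x 2 := hx (by decide)
  have h02 : x 0 < x 2 := hx (by decide)
  have hlow : ∀ v, π 1 v < π 2 v ↔ z 1 2 < v := by
    intro v
    have hz12 : z 1 2 = (Real.log (p 1 / p 2) + σ ^ 2 * x 2 ^ 2 * T / 2
        - σ ^ 2 * x 1 ^ 2 * T / 2) / (σ * x 2 - σ * x 1) := by
      rw [hz 1 2 (by decide), ← neg_div_neg_eq, ← inv_div (p 1), Real.log_inv]
      congr 1 <;> ring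
    rw [hπ, hπ, div_lt_div_iff_of_pos_right (hden v),
      mul_exp_lt_mul_exp_iff (hp0 1) (hp0 2) (by gcongr), hz12]
  have hupp : ∀ v, π 2 v < π 0 v ↔ v < z 2 0 := by
    intro v
    have hz20 : z 2 0 = (Real.log (p 0 / p 2) + σ ^ 2 * x 2 ^ 2 * T / 2
        - σ ^ 2 * x 0 ^ 2 * T / 2) / (σ * x 2 - σ * x 0) := by
      rw [hz 2 0 (by decide)]
      congr 1 <;> ring
    rw [hπ, hπ, div_lt_div_iff_of_pos_right (hden v),
      mul_exp_lt_mul_exp_iff' (hp0 0) (hp0 2) (by gcongr), hz20]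
  have hevent : {ω | π 1 (ξ ω) < π 2 (ξ ω) ∧ π 2 (ξ ω) < π 0 (ξ ω)}
      = ξ ⁻¹' Set.Ioo (z 1 2) (z 2 0) := by
    ext ω
    simp [hlow, hupp]
  rw [hevent]
  refine ⟨fun hlt ↦ ?_, fun hle ↦ by simp [Set.Ioo_eq_empty_of_le hle]⟩
  have hXreal : ∀ i, (ℙ : Measure Ω).real (X ⁻¹' {x i}) = p i := fun i ↦
    (congrArg ENNReal.toReal (hX i)).trans (ENNReal.toReal_ofReal (hp0 i).le)
  have hξm : Measurable ξ := by
    rw [funext hξ]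
    fun_prop
  rw [← measureReal_def, measureReal_eq_sum_inter_of_sum_eq_one hXmeas hx.injective
    (by simpa only [hXreal] using hpsum) (hξm measurableSet_Ioo)]
  refine Finset.sum_congr rfl fun j _ ↦ ?_
  have hset : X ⁻¹' {x j} ∩ ξ ⁻¹' Set.Ioo (z 1 2) (z 2 0) = X ⁻¹' {x j} ∩
      G ⁻¹' Set.Ioo (z 1 2 - σ * x j * T) (z 2 0 - σ * x j * T) := by
    ext ω
    simp only [Set.mem_inter_iff, Set.mem_preimage, Set.mem_singleton_iff, Set.mem_Ioo, hξ]
    refine and_congr_right fun h ↦ ?_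
    rw [h, sub_lt_iff_lt_add', lt_sub_iff_add_lt']
  rw [hset, measureReal_def, hindep.measure_inter_preimage_eq_mul _ _
    (measurableSet_singleton _) measurableSet_Ioo, ENNReal.toReal_mul, ← measureReal_def, hXreal,
    ← Measure.map_apply hGmeas measurableSet_Ioo, hG, ← measureReal_def,
    gaussianReal_real_Ioo hT (by gcongr)]
end

section
/- (Explicit ordering probability, last case) P( π_1(ξ_T) < π_2(ξ_T) < π_3(ξ_T) ) = Σ_{j=1}^{3} p_j · N( (σ x_j T − max{z_{12}, z_{23}})/√T ), where N denotes the standard normal cumulative distribution function. -/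
open MeasureTheory ProbabilityTheory

/-- The upper tail of a centred Gaussian in terms of the standard normal CDF. -/
lemma gaussianReal_Ioi_toReal {T : ℝ} (hT : 0 < T) (a : ℝ) :
    (gaussianReal 0 T.toNNReal (Set.Ioi a)).toReal = stdNormalCDF (-a / Real.sqrt T) := by
  have hs : 0 < Real.sqrt T := Real.sqrt_pos.2 hT
  have hmap : (gaussianReal 0 1).map (fun y => -Real.sqrt T * y) = gaussianReal 0 T.toNNReal := by
    rw [gaussianReal_map_const_mul]
    congr 1
    · simp
    · ext
      simp [Real.sq_sqrt hT.le, hT.le]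
  have hpre : (fun y => -Real.sqrt T * y) ⁻¹' Set.Ioi a = Set.Iio (-a / Real.sqrt T) := by
    ext y
    simp only [Set.mem_preimage, Set.mem_Ioi, Set.mem_Iio, lt_div_iff₀ hs]
    constructor <;> intro h <;> linarith
  have : NullSingletonClass (gaussianReal 0 1) := nullSingletonClass_gaussianReal one_ne_zero
  rw [← hmap, Measure.map_apply (by fun_prop) measurableSet_Ioi, hpre, stdNormalCDF,
    measure_congr Iio_ae_eq_Iic]

/-- Two exponentially tilted weights are ordered exactly above the crossing point. -/
lemma mul_exp_div_lt_mul_exp_div_iff {σ T a b p q S v : ℝ} (hσ : 0 < σ) (hab : a < b)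
    (hp : 0 < p) (hq : 0 < q) (hS : 0 < S) :
    p * Real.exp (σ * a * v - σ ^ 2 * a ^ 2 * T / 2) / S <
        q * Real.exp (σ * b * v - σ ^ 2 * b ^ 2 * T / 2) / S ↔
      (Real.log (q / p) + σ ^ 2 * (a ^ 2 - b ^ 2) * T / 2) / (σ * (a - b)) < v := by
  have hneg : σ * (a - b) < 0 := mul_neg_of_pos_of_neg hσ (sub_neg.2 hab)
  rw [div_lt_div_iff_of_pos_right hS, ← Real.log_lt_log_iff (by positivity) (by positivity),
    Real.log_mul hp.ne' (Real.exp_ne_zero _), Real.log_mul hq.ne' (Real.exp_ne_zero _),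
    Real.log_exp, Real.log_exp, div_lt_iff_of_neg hneg, Real.log_div hq.ne' hp.ne']
  constructor <;> intro h <;> linarith

/-- The law of total probability over finitely many values exhausting a random variable. -/
lemma measure_toReal_eq_sum_inter_fiber {Ω ι α : Type*} [MeasurableSpace Ω] [Fintype ι]
    [MeasurableSpace α] [MeasurableSingletonClass α]
    {μ : Measure Ω} [IsProbabilityMeasure μ] {X : Ω → α} (hX : Measurable X) {x : ι → α}
    (hx : Function.Injective x) (hsum : ∑ i, μ {ω | X ω = x i} = 1)
    {A : Set Ω} (hA : MeasurableSet A) :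
    (μ A).toReal = ∑ i, (μ ({ω | X ω = x i} ∩ A)).toReal := by
  have hmeas : ∀ i, MeasurableSet {ω | X ω = x i} := fun i => hX (measurableSet_singleton (x i))
  have hdisj : Pairwise (Function.onFun Disjoint fun i => {ω | X ω = x i}) := by
    intro i j hij
    refine Set.disjoint_left.2 fun ω hi hj => hij (hx ?_)
    exact (show X ω = x i from hi).symm.trans hj
  have hone : μ (⋃ i, {ω | X ω = x i}) = 1 := by
    rw [measure_iUnion hdisj hmeas, tsum_fintype, hsum]
  have hae : ∀ᵐ ω ∂μ, ω ∈ ⋃ i, {ω | X ω = x i} :=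
    (mem_ae_iff_prob_eq_one (MeasurableSet.iUnion hmeas)).2 hone
  have hcongr : μ A = μ (⋃ i, ({ω | X ω = x i} ∩ A)) := by
    refine measure_congr ?_
    filter_upwards [hae] with ω hω
    rw [← Set.iUnion_inter]
    exact propext ⟨fun h => ⟨hω, h⟩, fun h => h.2⟩
  rw [hcongr, measure_iUnion
    (fun i j hij => (hdisj hij).mono Set.inter_subset_left Set.inter_subset_left)
    (fun i => (hmeas i).inter hA), tsum_fintype,
    ENNReal.toReal_sum fun i _ => measure_ne_top _ _]

/-- **Explicit ordering probability, last case.**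
`P(π₁(ξ_T) < π₂(ξ_T) < π₃(ξ_T)) = ∑ j, p j * N((σ x_j T − max {z₁₂, z₂₃})/√T)`.
(Candidates `1,2,3` correspond to indices `0,1,2` of `Fin 3`.) -/
theorem ordering_probability_last_case
    {Ω : Type*} [MeasureSpace Ω] [IsProbabilityMeasure (ℙ : Measure Ω)]
    {T σ : ℝ} (hT : 0 < T) (hσ : 0 < σ)
    (x : Fin 3 → ℝ) (hx : StrictMono x)
    (p : Fin 3 → ℝ) (hp : ∀ i, p i ∈ Set.Ioo (0 : ℝ) 1) (hpsum : ∑ i, p i = 1)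
    (π : Fin 3 → ℝ → ℝ)
    (hπ : ∀ i v, π i v =
      p i * Real.exp (σ * x i * v - σ ^ 2 * x i ^ 2 * T / 2) /
        ∑ j, p j * Real.exp (σ * x j * v - σ ^ 2 * x j ^ 2 * T / 2))
    (z : Fin 3 → Fin 3 → ℝ)
    (hz : ∀ k j, k ≠ j → z k j =
      (Real.log (p j / p k) + σ ^ 2 * (x k ^ 2 - x j ^ 2) * T / 2) / (σ * (x k - x j)))
    (X G : Ω → ℝ) (hXmeas : Measurable X) (hGmeas : Measurable G)
    (hX : ∀ i, ℙ {ω | X ω = x i} = ENNReal.ofReal (p i))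
    (hG : Measure.map G ℙ = gaussianReal 0 T.toNNReal)
    (hindep : IndepFun X G ℙ)
    (ξ : Ω → ℝ) (hξ : ∀ ω, ξ ω = σ * X ω * T + G ω) :
    (ℙ {ω | π 0 (ξ ω) < π 1 (ξ ω) ∧ π 1 (ξ ω) < π 2 (ξ ω)}).toReal
      = ∑ j, p j * stdNormalCDF ((σ * x j * T - max (z 0 1) (z 1 2)) / Real.sqrt T) := by
  have hpos : ∀ i, 0 < p i := fun i => (hp i).1
  have hS : ∀ v, 0 < ∑ j, p j * Real.exp (σ * x j * v - σ ^ 2 * x j ^ 2 * T / 2) := fun v =>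
    Finset.sum_pos (fun j _ => mul_pos (hpos j) (Real.exp_pos _)) Finset.univ_nonempty
  have hlt : ∀ k j, k < j → ∀ v, π k v < π j v ↔ z k j < v := by
    intro k j hkj v
    rw [hπ, hπ, hz k j hkj.ne]
    exact mul_exp_div_lt_mul_exp_div_iff hσ (hx hkj) (hpos k) (hpos j) (hS v)
  set M := max (z 0 1) (z 1 2) with hM
  have hevent : {ω | π 0 (ξ ω) < π 1 (ξ ω) ∧ π 1 (ξ ω) < π 2 (ξ ω)} =
      {ω | M < σ * X ω * T + G ω} := by
    ext ω
    simp only [Set.mem_ofPred_eq, hlt 0 1 (by decide), hlt 1 2 (by decide), hM, max_lt_iff, hξ]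
  have hsum : ∑ i, (ℙ : Measure Ω) {ω | X ω = x i} = 1 := by
    simp only [hX]
    rw [← ENNReal.ofReal_sum_of_nonneg fun i _ => (hpos i).le, hpsum, ENNReal.ofReal_one]
  rw [hevent, measure_toReal_eq_sum_inter_fiber hXmeas hx.injective hsum
    (measurableSet_lt (by fun_prop) (by fun_prop))]
  refine Finset.sum_congr rfl fun j _ => ?_
  have hfiber : {ω | X ω = x j} ∩ {ω | M < σ * X ω * T + G ω} =
      X ⁻¹' {x j} ∩ G ⁻¹' Set.Ioi (M - σ * x j * T) := by
    ext ω
    simp only [Set.mem_inter_iff, Set.mem_ofPred_eq, Set.mem_preimage, Set.mem_singleton_iff,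
      Set.mem_Ioi]
    refine and_congr_right fun h => ?_
    rw [h, sub_lt_iff_lt_add']
  rw [hfiber, hindep.measure_inter_preimage_eq_mul _ _ (measurableSet_singleton _)
    measurableSet_Ioi, ENNReal.toReal_mul, ← Measure.map_apply hGmeas measurableSet_Ioi, hG,
    gaussianReal_Ioi_toReal hT, show X ⁻¹' {x j} = {ω | X ω = x j} from rfl, hX,
    ENNReal.toReal_ofReal (hpos j).le, neg_sub]
end

section
/- (Centre-ground trap) If z_{12} > z_{31} > z_{23}, then for no real ξ do both π_2(ξ) > π_1(ξ) and π_2(ξ) > π_3(ξ) hold; consequently, the probability that the middle candidate is the strict leader on election day is identically zero: P( π_2(ξ_T) > π_1(ξ_T) and π_2(ξ_T) > π_3(ξ_T) ) = 0. -/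
open MeasureTheory ProbabilityTheory

/-- Comparison of exponentially weighted positive numbers on the logarithmic scale. -/
theorem log_add_lt_of_mul_exp_lt {p q a b : ℝ} (hp : 0 < p) (hq : 0 < q)
    (h : p * Real.exp a < q * Real.exp b) : Real.log p + a < Real.log q + b := by
  have := Real.log_lt_log (by positivity) h
  rwa [Real.log_mul hp.ne' (Real.exp_ne_zero a), Real.log_mul hq.ne' (Real.exp_ne_zero b),
    Real.log_exp, Real.log_exp] at this

/-- **Centre-ground trap.** If `z₁₂ > z₃₁ > z₂₃`, then for no real `ξ` do both
`π₂(ξ) > π₁(ξ)` and `π₂(ξ) > π₃(ξ)` hold; consequently, the probability that the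
middle candidate is the strict leader on election day is identically zero.
(Candidates `1,2,3` correspond to indices `0,1,2` of `Fin 3`.) -/
theorem centre_ground_trap
    {Ω : Type*} [MeasureSpace Ω] [IsProbabilityMeasure (ℙ : Measure Ω)]
    {T σ : ℝ} (hT : 0 < T) (hσ : 0 < σ)
    (x : Fin 3 → ℝ) (hx : StrictMono x)
    (p : Fin 3 → ℝ) (hp : ∀ i, p i ∈ Set.Ioo (0 : ℝ) 1) (hpsum : ∑ i, p i = 1)
    (π : Fin 3 → ℝ → ℝ)
    (hπ : ∀ i v, π i v =
      p i * Real.exp (σ * x i * v - σ ^ 2 * x i ^ 2 * T / 2) /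
        ∑ j, p j * Real.exp (σ * x j * v - σ ^ 2 * x j ^ 2 * T / 2))
    (z : Fin 3 → Fin 3 → ℝ)
    (hz : ∀ k j, k ≠ j → z k j =
      (Real.log (p j / p k) + σ ^ 2 * (x k ^ 2 - x j ^ 2) * T / 2) / (σ * (x k - x j)))
    (X G : Ω → ℝ) (hXmeas : Measurable X) (hGmeas : Measurable G)
    (hX : ∀ i, ℙ {ω | X ω = x i} = ENNReal.ofReal (p i))
    (hG : Measure.map G ℙ = gaussianReal 0 T.toNNReal)
    (hindep : IndepFun X G ℙ)
    (ξ : Ω → ℝ) (hξ : ∀ ω, ξ ω = σ * X ω * T + G ω)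
    (htrap : z 2 0 < z 0 1 ∧ z 1 2 < z 2 0) :
    (∀ v : ℝ, ¬ (π 1 v > π 0 v ∧ π 1 v > π 2 v)) ∧
    ℙ {ω | π 1 (ξ ω) > π 0 (ξ ω) ∧ π 1 (ξ ω) > π 2 (ξ ω)} = 0 := by
  have hp0 (i : Fin 3) : 0 < p i := (hp i).1
  have hlog {i j : Fin 3} {v : ℝ} (h : π i v < π j v) :
      Real.log (p i) + (σ * x i * v - σ ^ 2 * x i ^ 2 * T / 2) <
        Real.log (p j) + (σ * x j * v - σ ^ 2 * x j ^ 2 * T / 2) := by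
    have hS : 0 < ∑ j, p j * Real.exp (σ * x j * v - σ ^ 2 * x j ^ 2 * T / 2) :=
      Finset.sum_pos (fun j _ => mul_pos (hp0 j) (Real.exp_pos _)) Finset.univ_nonempty
    rw [hπ, hπ, div_lt_div_iff_of_pos_right hS] at h
    exact log_add_lt_of_mul_exp_lt (hp0 i) (hp0 j) h
  have key (v : ℝ) : ¬ (π 1 v > π 0 v ∧ π 1 v > π 2 v) := by
    rintro ⟨h₀, h₂⟩
    have hlower : z 0 1 < v := by
      have hneg : σ * (x 0 - x 1) < 0 := mul_neg_of_pos_of_neg hσ (sub_neg.2 (hx (by decide)))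
      rw [hz 0 1 (by decide), div_lt_iff_of_neg hneg, Real.log_div (hp0 1).ne' (hp0 0).ne']
      linarith [hlog h₀]
    have hupper : v < z 1 2 := by
      have hneg : σ * (x 1 - x 2) < 0 := mul_neg_of_pos_of_neg hσ (sub_neg.2 (hx (by decide)))
      rw [hz 1 2 (by decide), lt_div_iff_of_neg hneg, Real.log_div (hp0 2).ne' (hp0 1).ne']
      linarith [hlog h₂]
    linarith [htrap.1, htrap.2]
  exact ⟨key, by simp only [key, Set.ofPred_false, measure_empty]⟩
end

section
/- (Information flow rate bound for the centre-ground trap) Writing ω_{ij} = x_j − x_i, the double inequality z_{12} > z_{31} > z_{23} holds if and only if σ² < (2 / (ω_{12} ω_{23} ω_{31} T)) · min{ ω_{12} log(p_1/p_3) − ω_{13} log(p_1/p_2), ω_{32} log(p_1/p_3) − ω_{13} log(p_3/p_2) }. -/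
/-- **Information flow rate bound for the centre-ground trap.** Writing
`ω_ij = x j − x i`, the double inequality `z₁₂ > z₃₁ > z₂₃` holds if and only if
`σ² < (2 / (ω₁₂ ω₂₃ ω₃₁ T)) * min {ω₁₂ log(p₁/p₃) − ω₁₃ log(p₁/p₂),
ω₃₂ log(p₁/p₃) − ω₁₃ log(p₃/p₂)}`.
(Candidates `1,2,3` correspond to indices `0,1,2` of `Fin 3`.) -/
theorem information_flow_rate_bound
    {T σ : ℝ} (hT : 0 < T) (hσ : 0 < σ)
    (x : Fin 3 → ℝ) (hx : StrictMono x)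
    (p : Fin 3 → ℝ) (hp : ∀ i, p i ∈ Set.Ioo (0 : ℝ) 1) (hpsum : ∑ i, p i = 1)
    (z : Fin 3 → Fin 3 → ℝ)
    (hz : ∀ k j, k ≠ j → z k j =
      (Real.log (p j / p k) + σ ^ 2 * (x k ^ 2 - x j ^ 2) * T / 2) / (σ * (x k - x j)))
    (ω : Fin 3 → Fin 3 → ℝ) (hω : ∀ i j, ω i j = x j - x i) :
    (z 2 0 < z 0 1 ∧ z 1 2 < z 2 0) ↔
      σ ^ 2 < 2 / (ω 0 1 * ω 1 2 * ω 2 0 * T) *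
        min (ω 0 1 * Real.log (p 0 / p 2) - ω 0 2 * Real.log (p 0 / p 1))
            (ω 2 1 * Real.log (p 0 / p 2) - ω 0 2 * Real.log (p 2 / p 1)) := by
  have h01 : 0 < x 1 - x 0 := sub_pos.2 (hx (by decide))
  have h12 : 0 < x 2 - x 1 := sub_pos.2 (hx (by decide))
  have h02 : 0 < x 2 - x 0 := sub_pos.2 (hx (by decide))
  have hlog : ∀ i j, Real.log (p i / p j) = Real.log (p i) - Real.log (p j) := fun i j ↦
    Real.log_div (hp i).1.ne' (hp j).1.ne'
  have hmin : ω 2 1 * Real.log (p 0 / p 2) - ω 0 2 * Real.log (p 2 / p 1) =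
      ω 0 1 * Real.log (p 0 / p 2) - ω 0 2 * Real.log (p 0 / p 1) := by
    simp only [hω, hlog]
    ring
  rw [hmin, min_self, hz 2 0 (by decide), hz 0 1 (by decide), hz 1 2 (by decide)]
  simp only [hω, hlog]
  generalize Real.log (p 0) = a
  generalize Real.log (p 1) = b
  generalize Real.log (p 2) = c
  generalize x 0 = u at *
  generalize x 1 = v at *
  generalize x 2 = w at *
  set D := 2 / ((v - u) * (w - v) * (u - w) * T) *
    ((v - u) * (a - c) - (w - u) * (a - b)) - σ ^ 2 with hD
  have hu : u - v ≠ 0 := by linarith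
  have hv : v - w ≠ 0 := by linarith
  have hw : u - w ≠ 0 := by linarith
  have e₁ : (b - a + σ ^ 2 * (u ^ 2 - v ^ 2) * T / 2) / (σ * (u - v)) -
      (a - c + σ ^ 2 * (w ^ 2 - u ^ 2) * T / 2) / (σ * (w - u)) =
      T * (w - v) / (2 * σ) * D := by
    rw [hD]
    field_simp
    ring
  have e₂ : (a - c + σ ^ 2 * (w ^ 2 - u ^ 2) * T / 2) / (σ * (w - u)) -
      (c - b + σ ^ 2 * (v ^ 2 - w ^ 2) * T / 2) / (σ * (v - w)) =
      T * (v - u) / (2 * σ) * D := by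
    rw [hD]
    field_simp
    ring
  rw [← sub_pos, e₁, ← sub_pos (b := (c - b + _) / _), e₂, ← sub_pos (b := σ ^ 2), ← hD,
    mul_pos_iff_of_pos_left (by positivity), mul_pos_iff_of_pos_left (by positivity), and_self]
end

section
/- (Unimodality of an interior candidate's support curve) Fix an index k with 1 < k < N. Then there exists a unique real ξ* satisfying Σ_{j=1}^{N} (x_j − x_k) p_j exp(σ x_j ξ* − ½σ²x_j²T) = 0; moreover, π_k is strictly increasing on (−∞, ξ*] and strictly decreasing on [ξ*, ∞), so that π_k attains its maximum value at ξ*, and this maximum value π_k(ξ*) is strictly less than 1. -/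
open Filter in
/-- A positive combination of exponentials with a negative and a positive rate has a minimizer. -/
theorem exists_forall_expSum_le {ι : Type*} [Fintype ι] {a c : ι → ℝ} (hc : ∀ j, 0 < c j)
    {l r : ι} (hl : a l < 0) (hr : 0 < a r) :
    ∃ z, ∀ v, ∑ j, c j * Real.exp (a j * z) ≤ ∑ j, c j * Real.exp (a j * v) := by
  have single_le (i : ι) (v : ℝ) :
      c i * Real.exp (a i * v) ≤ ∑ j, c j * Real.exp (a j * v) :=
    Finset.single_le_sum (f := fun j => c j * Real.exp (a j * v))
      (fun j _ => (mul_pos (hc j) (Real.exp_pos _)).le) (Finset.mem_univ i)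
  refine Continuous.exists_forall_le (by fun_prop) ?_
  rw [cocompact_eq_atBot_atTop, tendsto_sup]
  constructor
  · exact tendsto_atTop_mono (single_le l) ((Real.tendsto_exp_atTop.comp
      (tendsto_id.const_mul_atBot_of_neg hl)).const_mul_atTop (hc l))
  · exact tendsto_atTop_mono (single_le r) ((Real.tendsto_exp_atTop.comp
      (tendsto_id.const_mul_atTop hr)).const_mul_atTop (hc r))

theorem hasDerivAt_expSum {ι : Type*} [Fintype ι] (a c : ι → ℝ) (v : ℝ) :
    HasDerivAt (fun v => ∑ j, c j * Real.exp (a j * v))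
      (∑ j, a j * c j * Real.exp (a j * v)) v := by
  refine HasDerivAt.fun_sum fun j _ => ?_
  exact ((hasDerivAt_const_mul (a j)).exp.const_mul (c j)).congr_deriv (by ring)

theorem strictMono_expSum_deriv {ι : Type*} [Fintype ι] {a c : ι → ℝ} (hc : ∀ j, 0 < c j)
    {r : ι} (hr : 0 < a r) : StrictMono fun v => ∑ j, a j * c j * Real.exp (a j * v) := by
  intro v w hvw
  refine Finset.sum_lt_sum (fun j _ => ?_) ⟨r, Finset.mem_univ r, ?_⟩
  · rcases le_total 0 (a j) with h | h
    · have := hc j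
      gcongr
    · exact mul_le_mul_of_nonpos_left
        (Real.exp_le_exp.2 (mul_le_mul_of_nonpos_left hvw.le h))
        (mul_nonpos_of_nonpos_of_nonneg h (hc j).le)
  · have := hc r
    gcongr

/-- A positive combination of exponentials with a negative and a positive rate is strictly
decreasing and then strictly increasing, with turning point the unique zero of its derivative. -/
theorem expSum_unimodal {ι : Type*} [Fintype ι] {a c : ι → ℝ} (hc : ∀ j, 0 < c j)
    {l r : ι} (hl : a l < 0) (hr : 0 < a r) :
    ∃ z, (∑ j, a j * c j * Real.exp (a j * z) = 0) ∧
      (∀ w, ∑ j, a j * c j * Real.exp (a j * w) = 0 → w = z) ∧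
      StrictAntiOn (fun v => ∑ j, c j * Real.exp (a j * v)) (Set.Iic z) ∧
      StrictMonoOn (fun v => ∑ j, c j * Real.exp (a j * v)) (Set.Ici z) ∧
      ∀ v, ∑ j, c j * Real.exp (a j * z) ≤ ∑ j, c j * Real.exp (a j * v) := by
  obtain ⟨z, hz⟩ := exists_forall_expSum_le hc hl hr
  have hmono := strictMono_expSum_deriv hc hr
  have hzero : ∑ j, a j * c j * Real.exp (a j * z) = 0 :=
    IsLocalMin.hasDerivAt_eq_zero (Filter.Eventually.of_forall hz) (hasDerivAt_expSum a c z)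
  refine ⟨z, hzero, fun w hw => hmono.injective (hw.trans hzero.symm), ?_, ?_, hz⟩
  · refine strictAntiOn_of_deriv_neg (convex_Iic z) (by fun_prop) fun v hv => ?_
    rw [interior_Iic] at hv
    rw [(hasDerivAt_expSum a c v).deriv, ← hzero]
    exact hmono hv
  · refine strictMonoOn_of_deriv_pos (convex_Ici z) (by fun_prop) fun v hv => ?_
    rw [interior_Ici] at hv
    rw [(hasDerivAt_expSum a c v).deriv, ← hzero]
    exact hmono hv

/-- **Unimodality of an interior candidate's support curve.** For an interior
index `k` (i.e. `0 < k < N − 1` in zero-based indexing), there is a unique real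
`ξ*` with `∑ j, (x j − x k) p j exp(σ x j ξ* − σ² x_j² T / 2) = 0`; moreover
`π k` is strictly increasing on `(−∞, ξ*]`, strictly decreasing on `[ξ*, ∞)`,
attains its maximum at `ξ*`, and `π k ξ* < 1`. -/
theorem interior_candidate_unimodal
    {N : ℕ} (hN : 3 ≤ N) {T σ : ℝ} (hT : 0 < T) (hσ : 0 < σ)
    (x : Fin N → ℝ) (hx : StrictMono x)
    (p : Fin N → ℝ) (hp : ∀ i, p i ∈ Set.Ioo (0 : ℝ) 1) (hpsum : ∑ i, p i = 1)
    (π : Fin N → ℝ → ℝ)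
    (hπ : ∀ i v, π i v =
      p i * Real.exp (σ * x i * v - σ ^ 2 * x i ^ 2 * T / 2) /
        ∑ j, p j * Real.exp (σ * x j * v - σ ^ 2 * x j ^ 2 * T / 2))
    (k : Fin N) (hk0 : 0 < (k : ℕ)) (hkN : (k : ℕ) < N - 1) :
    ∃ ξstar : ℝ,
      (∑ j, (x j - x k) * p j * Real.exp (σ * x j * ξstar - σ ^ 2 * x j ^ 2 * T / 2) = 0) ∧
      (∀ ξ' : ℝ,
        (∑ j, (x j - x k) * p j * Real.exp (σ * x j * ξ' - σ ^ 2 * x j ^ 2 * T / 2) = 0)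
          → ξ' = ξstar) ∧
      StrictMonoOn (π k) (Set.Iic ξstar) ∧
      StrictAntiOn (π k) (Set.Ici ξstar) ∧
      (∀ v : ℝ, π k v ≤ π k ξstar) ∧
      π k ξstar < 1 := by
  set c : Fin N → ℝ := fun j => p j * Real.exp (-(σ ^ 2 * x j ^ 2 * T / 2)) with hc_def
  set a : Fin N → ℝ := fun j => σ * (x j - x k) with ha_def
  have hc (j : Fin N) : 0 < c j := mul_pos (hp j).1 (Real.exp_pos _)
  have hl : a ⟨0, by omega⟩ < 0 := mul_neg_of_pos_of_neg hσ (sub_neg.2 (hx hk0))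
  have hr : 0 < a ⟨N - 1, by omega⟩ := mul_pos hσ (sub_pos.2 (hx hkN))
  have hterm (j : Fin N) (v : ℝ) :
      p j * Real.exp (σ * x j * v - σ ^ 2 * x j ^ 2 * T / 2) =
        Real.exp (σ * x k * v) * (c j * Real.exp (a j * v)) := by
    rw [show σ * x j * v - σ ^ 2 * x j ^ 2 * T / 2 =
      σ * x k * v + -(σ ^ 2 * x j ^ 2 * T / 2) + a j * v by simp only [ha_def]; ring,
      Real.exp_add, Real.exp_add]
    simp only [hc_def]
    ring
  have hzero_iff (v : ℝ) :
      (∑ j, (x j - x k) * p j * Real.exp (σ * x j * v - σ ^ 2 * x j ^ 2 * T / 2) = 0) ↔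
        ∑ j, a j * c j * Real.exp (a j * v) = 0 := by
    have h : σ * ∑ j, (x j - x k) * p j * Real.exp (σ * x j * v - σ ^ 2 * x j ^ 2 * T / 2) =
        Real.exp (σ * x k * v) * ∑ j, a j * c j * Real.exp (a j * v) := by
      rw [Finset.mul_sum, Finset.mul_sum]
      refine Finset.sum_congr rfl fun j _ => ?_
      rw [mul_assoc (x j - x k), hterm]
      simp only [ha_def]
      ring
    rw [← mul_eq_zero_iff_left hσ.ne', h, mul_eq_zero,
      or_iff_right (Real.exp_ne_zero _)]
  have hπk (v : ℝ) : π k v = c k / ∑ j, c j * Real.exp (a j * v) := by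
    simp only [hπ, hterm]
    rw [← Finset.mul_sum, mul_div_mul_left _ _ (Real.exp_ne_zero _)]
    simp [ha_def]
  have hpos (v : ℝ) : 0 < ∑ j, c j * Real.exp (a j * v) :=
    Finset.sum_pos (fun j _ => mul_pos (hc j) (Real.exp_pos _)) ⟨k, Finset.mem_univ k⟩
  obtain ⟨z, hz, huniq, hanti, hmono, hmin⟩ := expSum_unimodal hc hl hr
  refine ⟨z, (hzero_iff z).2 hz, fun w hw => huniq w ((hzero_iff w).1 hw), ?_, ?_, ?_, ?_⟩
  · intro v hv w hw hvw
    rw [hπk, hπk]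
    exact div_lt_div_of_pos_left (hc k) (hpos w) (hanti hv hw hvw)
  · intro v hv w hw hvw
    rw [hπk, hπk]
    exact div_lt_div_of_pos_left (hc k) (hpos v) (hmono hv hw hvw)
  · intro v
    rw [hπk, hπk]
    exact div_le_div_of_nonneg_left (hc k).le (hpos z) (hmin v)
  · rw [hπk, div_lt_one (hpos z)]
    have h0k : (⟨0, by omega⟩ : Fin N) ≠ k := fun h => by simp [← h] at hk0
    have := Finset.single_lt_sum (f := fun j => c j * Real.exp (a j * z)) h0k
      (Finset.mem_univ k) (Finset.mem_univ _) (mul_pos (hc _) (Real.exp_pos _))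
      fun j _ _ => (mul_pos (hc j) (Real.exp_pos _)).le
    simpa [ha_def] using this
end
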